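/- arXiv:2602.17237 — 2 statements merged into one kernel-verified Lean document; each statement's English description precedes it below -/
import Mathlib

section
/- Let B₁ and B₂ be compatible saturated BDDTSs and let B = B₁ ▽ B₂ be their disjunction composition. Fix an initialisation ini assigning a closed term to every variable. Then for every interaction sequence σ, every location l = (l₁, l₂) of B, every path π ∈ LP_B(σ, l), and each i ∈ {1,2} such that the i-th component lᵢ of l is a location of Bᵢ (i.e., lᵢ ≠ ⊥), there exists a path πᵢ ∈ LP_{Bᵢ}(σ, lᵢ) such that πᵢ ⊑ π (πᵢ is subsumed by π). -/
/-!
A formal model of BDDTSs (Behaviour-Driven Development Transition Systems).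

Formulas are modelled semantically:
* `D` is the type of data values (closed terms are identified with the values they denote);
* a *world* `w : ℕ → D` is a valuation of the (indexed, `⇑`-shifted) interaction variables;
* a switch guard is a set of pairs (data valuation, current interaction parameter);
* an initial guard / output goal is a set of data valuations;
* a *condition* (path condition, execution condition, goal implication) is a set of pairs
  (data valuation, world); logical equivalence of such formulas is equality of sets,
  implication is inclusion.
-/

universe u

/-- Worlds: valuations of the (indexed) interaction variables. -/
abbrev World (D : Type) := ℕ → D

/-- Symbolic terms over the data variables and the current interaction parameter. -/
abbrev STerm (V D : Type) := (V → D) → D → D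

/-- Switch guards: formulas over the data variables and the current interaction parameter. -/
abbrev SForm (V D : Type) := Set ((V → D) × D)

/-- Formulas over the data variables only (initial guards and output goals). -/
abbrev VForm (V D : Type) := Set (V → D)

/-- Conditions: formulas over the data variables and the interaction variables. -/
abbrev Cond (V D : Type) := Set ((V → D) × World D)

/-- Partial assignments of symbolic terms to variables. -/
abbrev Assign (V D : Type) := V → Option (STerm V D)

/-- A BDDTS `⟨L, V, G, →, il, IG, OG⟩` over locations `L`, variables `V`, data `D`
and interactions `I` (interactions over the gates `G`). -/
structure BDDTS (L V D I : Type) where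
  /-- the switch relation `l —(α,φ,a)→ l'` -/
  trans : L → I → SForm V D → Assign V D → L → Prop
  /-- the initial location -/
  il : L
  /-- the initial guard -/
  IG : VForm V D
  /-- the (partial) output-goal assignment; `OG l = some ψ` means `OG ↓ l` -/
  OG : L → Option (VForm V D)

/-- Switch labels `(α, φ, a)`. -/
abbrev Label (V D I : Type) := I × SForm V D × Assign V D

/-- Paths: sequences of switch labels. -/
abbrev BPath (V D I : Type) := List (Label V D I)

variable {V D I L L₁ L₂ : Type}

/-- `Run B l π l'` : the labels `π` form a run from `l` to `l'`. -/
inductive Run (B : BDDTS L V D I) : L → BPath V D I → L → Prop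
  | nil (l : L) : Run B l [] l
  | cons {l l' l'' : L} {α : I} {φ : SForm V D} {a : Assign V D} {π : BPath V D I} :
      B.trans l α φ a l' → Run B l' π l'' → Run B l ((α, φ, a) :: π) l''

/-- The interaction sequence `σ_π` of a path. -/
def iseq (π : BPath V D I) : List I := π.map Prod.fst

/-- Location paths: `LP B σ l = {π | il —π→ l, σ_π = σ}`. -/
def LP (B : BDDTS L V D I) (σ : List I) (l : L) : Set (BPath V D I) :=
  {π | Run B B.il π l ∧ iseq π = σ}

/-- Subsumption of partial assignments: `a₁ ⊑ a₂`. -/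
def AsgSub (a₁ a₂ : Assign V D) : Prop := ∀ x t, a₁ x = some t → a₂ x = some t

/-- Subsumption of switch labels: same interaction, the second guard implies the first,
and the first assignment is subsumed by the second. -/
def LabelSub (lb₁ lb₂ : Label V D I) : Prop :=
  lb₁.1 = lb₂.1 ∧ lb₂.2.1 ⊆ lb₁.2.1 ∧ AsgSub lb₁.2.2 lb₂.2.2

/-- Subsumption of paths: `π₁ ⊑ π₂`, elementwise label subsumption. -/
def PathSub (π₁ π₂ : BPath V D I) : Prop := List.Forall₂ LabelSub π₁ π₂

/-- Location paths subsuming a given path: `LP B (σ, l ∣ π')`. -/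
def LPc (B : BDDTS L V D I) (σ : List I) (l : L) (π' : BPath V D I) : Set (BPath V D I) :=
  {ϖ ∈ LP B σ l | PathSub π' ϖ}

/-- Shifting a term to fresh copies of the interaction variables (`t⇑`). -/
def tshift (t : World D → D) : World D → D := fun w => t (w ∘ Nat.succ)

/-- One step of accumulation of a symbolic assignment. -/
def accStep (s : V → World D → D) (a : Assign V D) : V → World D → D := fun x =>
  match a x with
  | some t => fun w => t (fun v => tshift (s v) w) (w 0)
  | none => tshift (s x)

/-- Accumulated symbolic assignment along a reversed path. -/
def accRev (ini : V → D) : BPath V D I → V → World D → D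
  | [] => fun x _ => ini x
  | (_, _, a) :: ρ => accStep (accRev ini ρ) a

/-- The accumulated symbolic assignment `a^{ini}_π` along a path, starting from
the initialisation `ini` of closed terms. -/
def acc (ini : V → D) (π : BPath V D I) : V → World D → D := accRev ini π.reverse

/-- Shifting a condition on worlds (`⇑`). -/
def cshift (c : Set (World D)) : Set (World D) := {w | (w ∘ Nat.succ) ∈ c}

/-- BPath condition along a reversed path:
`η_ε = true`, `η_{π·(α,φ,a)} = η_π⇑ ∧ φ[a^{ini}_π⇑]`. -/
def etaWRev (ini : V → D) : BPath V D I → Set (World D)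
  | [] => Set.univ
  | (_, φ, _) :: ρ =>
      cshift (etaWRev ini ρ) ∩ {w | ((fun v => tshift (accRev ini ρ v) w), w 0) ∈ φ}

/-- The path condition `η^{ini}_π`, as a condition over data and interaction variables. -/
def eta (ini : V → D) (π : BPath V D I) : Cond V D := {p | p.2 ∈ etaWRev ini π.reverse}

/-- Substitution of an accumulated symbolic assignment into a formula over
the data variables: `ψ[s]`. -/
def substV (ψ : VForm V D) (s : V → World D → D) : Cond V D :=
  {p | (fun v => s v p.2) ∈ ψ}

/-- The execution condition `EC_{B,ini}(σ) = IG ∧ ⋁{η^{ini}_π ∣ il —π→ l, σ_π = σ}`. -/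
def EC (B : BDDTS L V D I) (ini : V → D) (σ : List I) : Cond V D :=
  {p | p.1 ∈ B.IG ∧ ∃ π l, Run B B.il π l ∧ iseq π = σ ∧ p ∈ eta ini π}

/-- The goal implication
`GI_{B,ini}(σ) = ⋀{η^{ini}_π ⇒ OG(l)[a^{ini}_π] ∣ il —π→ l, OG ↓ l, σ_π = σ}`. -/
def GI (B : BDDTS L V D I) (ini : V → D) (σ : List I) : Cond V D :=
  {p | ∀ π l ψ, Run B B.il π l → iseq π = σ → B.OG l = some ψ →
      p ∈ eta ini π → p ∈ substV ψ (acc ini π)}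

/-- Merge `a₁ ⊔ a₂` of (compatible) assignments. -/
def mergeA (a₁ a₂ : Assign V D) : Assign V D := fun x => (a₁ x).orElse (fun _ => a₂ x)

/-- Locations of the disjunction composition: pairs whose components may be `⊥` (`none`). -/
abbrev DLoc (L₁ L₂ : Type) := Option L₁ × Option L₂

/-- The switches of the disjunction composition `B₁ ▽ B₂`:
Rule 1 (`sync`) synchronises `α`-switches of both components with guard `φ₁ ∧ φ₂` and
assignment `a₁ ⊔ a₂`; Rules 2-1 (`left`) and 2-2 (`right`) let one component move alone
when the other component is `⊥` or has no outgoing `α`-switch. -/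
inductive DTrans (B₁ : BDDTS L₁ V D I) (B₂ : BDDTS L₂ V D I) :
    DLoc L₁ L₂ → I → SForm V D → Assign V D → DLoc L₁ L₂ → Prop
  | sync {l₁ l₁' : L₁} {l₂ l₂' : L₂} {α : I} {φ₁ φ₂ : SForm V D} {a₁ a₂ : Assign V D} :
      B₁.trans l₁ α φ₁ a₁ l₁' → B₂.trans l₂ α φ₂ a₂ l₂' →
      DTrans B₁ B₂ (some l₁, some l₂) α (φ₁ ∩ φ₂) (mergeA a₁ a₂) (some l₁', some l₂')
  | left {l₁ l₁' : L₁} {o₂ : Option L₂} {α : I} {φ₁ : SForm V D} {a₁ : Assign V D} :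
      B₁.trans l₁ α φ₁ a₁ l₁' →
      (∀ l₂ ∈ o₂, ∀ φ₂ a₂ l₂', ¬ B₂.trans l₂ α φ₂ a₂ l₂') →
      DTrans B₁ B₂ (some l₁, o₂) α φ₁ a₁ (some l₁', none)
  | right {l₂ l₂' : L₂} {o₁ : Option L₁} {α : I} {φ₂ : SForm V D} {a₂ : Assign V D} :
      B₂.trans l₂ α φ₂ a₂ l₂' →
      (∀ l₁ ∈ o₁, ∀ φ₁ a₁ l₁', ¬ B₁.trans l₁ α φ₁ a₁ l₁') →
      DTrans B₁ B₂ (o₁, some l₂) α φ₂ a₂ (none, some l₂')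

/-- Output goal of the composition: the conjunction when both components' goals are
defined, the defined one otherwise. -/
def mergeOG (o₁ o₂ : Option (VForm V D)) : Option (VForm V D) :=
  match o₁, o₂ with
  | some ψ₁, some ψ₂ => some (ψ₁ ∩ ψ₂)
  | some ψ₁, none => some ψ₁
  | none, o => o

/-- The disjunction composition `B₁ ▽ B₂`, with initial guard `IG₁ ∨ IG₂`. -/
def disj (B₁ : BDDTS L₁ V D I) (B₂ : BDDTS L₂ V D I) : BDDTS (DLoc L₁ L₂) V D I where
  trans := DTrans B₁ B₂
  il := (some B₁.il, some B₂.il)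
  IG := B₁.IG ∪ B₂.IG
  OG := fun l => mergeOG (l.1.bind B₁.OG) (l.2.bind B₂.OG)

/-- Compatibility of BDDTSs: their assignments agree wherever both are defined. -/
def Compatible (B₁ : BDDTS L₁ V D I) (B₂ : BDDTS L₂ V D I) : Prop :=
  ∀ l₁ α φ₁ a₁ l₁' l₂ φ₂ a₂ l₂', B₁.trans l₁ α φ₁ a₁ l₁' → B₂.trans l₂ α φ₂ a₂ l₂' →
    ∀ x t₁ t₂, a₁ x = some t₁ → a₂ x = some t₂ → t₁ = t₂

/-- A saturated BDDTS: (1) for every location and interaction `α`, the disjunction of the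
guards of the outgoing `α`-switches is logically equivalent to `true`, and (3) the guard of
every switch from the initial location to a non-sink location implies `IG`. -/
def Saturated (B : BDDTS L V D I) : Prop :=
  (∀ l α, (∃ φ a l', B.trans l α φ a l') →
      sSup {φ | ∃ a l', B.trans l α φ a l'} = (Set.univ : SForm V D)) ∧
  (∀ α φ a l', B.trans B.il α φ a l' → (∃ β ψ b l'', B.trans l' β ψ b l'') →
      ∀ p ∈ φ, p.1 ∈ B.IG)

/-- Label injection in the first position: `Proj₁ l₁`. -/
def Proj1 (l₁ : L₁) : Set (DLoc L₁ L₂) := {l | l.1 = some l₁}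

/-- Label injection in the second position: `Proj₂ l₂`. -/
def Proj2 (l₂ : L₂) : Set (DLoc L₁ L₂) := {l | l.2 = some l₂}

/-- Determinism: two `α`-switches from the same location are either equal or have
mutually exclusive guards. -/
def Deterministic (B : BDDTS L V D I) : Prop :=
  ∀ l α φ a l' φ' a' l'', B.trans l α φ a l' → B.trans l α φ' a' l'' →
    (φ = φ' ∧ a = a' ∧ l' = l'') ∨ φ ∩ φ' = ∅

/-- Path subsumption preserves the interaction sequence. -/
theorem PathSub.iseq_eq {π₁ π₂ : BPath V D I} (h : PathSub π₁ π₂) : iseq π₁ = iseq π₂ := by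
  induction h with
  | nil => rfl
  | cons hlb _ ih => exact congrArg₂ List.cons hlb.1 ih

/-- Runs project along a partial map of locations whenever switches do so up to subsumption. -/
theorem Run.exists_pathSub {L' : Type} {B : BDDTS L V D I} {B' : BDDTS L' V D I}
    (f : L → Option L')
    (hf : ∀ {l α φ a l'}, B.trans l α φ a l' → ∀ m', f l' = some m' →
      ∃ m, f l = some m ∧ ∃ ψ b, B'.trans m α ψ b m' ∧ φ ⊆ ψ ∧ AsgSub b a)
    {s l : L} {π : BPath V D I} (h : Run B s π l) (m : L') (hm : f l = some m) :
    ∃ r, f s = some r ∧ ∃ ϖ, Run B' r ϖ m ∧ PathSub ϖ π := by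
  induction h with
  | nil l => exact ⟨m, hm, [], .nil m, .nil⟩
  | cons ht _ ih =>
    obtain ⟨r, hr, ϖ, hϖ, hsub⟩ := ih hm
    obtain ⟨q, hq, ψ, b, ht', hψ, hb⟩ := hf ht r hr
    exact ⟨q, hq, _, .cons ht' hϖ, .cons ⟨rfl, hψ, hb⟩ hsub⟩

theorem AsgSub.refl (a : Assign V D) : AsgSub a a := fun _ _ h => h

theorem asgSub_mergeA_left (a₁ a₂ : Assign V D) : AsgSub a₁ (mergeA a₁ a₂) := by
  intro x t h
  simp [mergeA, h]

theorem asgSub_mergeA_right {a₁ a₂ : Assign V D}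
    (h : ∀ x t₁ t₂, a₁ x = some t₁ → a₂ x = some t₂ → t₁ = t₂) :
    AsgSub a₂ (mergeA a₁ a₂) := by
  intro x t h₂
  cases h₁ : a₁ x with
  | none => simp [mergeA, h₁, h₂]
  | some t₁ => simp [mergeA, h₁, h x t₁ t h₁ h₂]

theorem DTrans.exists_fst {B₁ : BDDTS L₁ V D I} {B₂ : BDDTS L₂ V D I} {l l' : DLoc L₁ L₂}
    {α : I} {φ : SForm V D} {a : Assign V D} (h : DTrans B₁ B₂ l α φ a l')
    (m' : L₁) (hm' : l'.1 = some m') :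
    ∃ m, l.1 = some m ∧ ∃ ψ b, B₁.trans m α ψ b m' ∧ φ ⊆ ψ ∧ AsgSub b a := by
  cases h with
  | sync h₁ h₂ =>
    cases hm'
    exact ⟨_, rfl, _, _, h₁, Set.inter_subset_left, asgSub_mergeA_left _ _⟩
  | left h₁ _ =>
    cases hm'
    exact ⟨_, rfl, _, _, h₁, subset_rfl, .refl _⟩
  | right => cases hm'

theorem DTrans.exists_snd {B₁ : BDDTS L₁ V D I} {B₂ : BDDTS L₂ V D I}
    (hcomp : Compatible B₁ B₂) {l l' : DLoc L₁ L₂}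
    {α : I} {φ : SForm V D} {a : Assign V D} (h : DTrans B₁ B₂ l α φ a l')
    (m' : L₂) (hm' : l'.2 = some m') :
    ∃ m, l.2 = some m ∧ ∃ ψ b, B₂.trans m α ψ b m' ∧ φ ⊆ ψ ∧ AsgSub b a := by
  cases h with
  | sync h₁ h₂ =>
    cases hm'
    exact ⟨_, rfl, _, _, h₂, Set.inter_subset_right,
      asgSub_mergeA_right (hcomp _ _ _ _ _ _ _ _ _ h₁ h₂)⟩
  | left => cases hm'
  | right h₂ _ =>
    cases hm'
    exact ⟨_, rfl, _, _, h₂, subset_rfl, .refl _⟩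

/-- **Path subsumption.** For compatible saturated `B₁`, `B₂` and `B = B₁ ▽ B₂`, any
initialisation `ini`, any interaction sequence `σ`, any location `l = (l₁, l₂)` of `B`
and any path `π ∈ LP_B(σ, l)`: for each `i ∈ {1,2}` such that `lᵢ ≠ ⊥`, there is a path
`πᵢ ∈ LP_{Bᵢ}(σ, lᵢ)` with `πᵢ ⊑ π`. -/
theorem path_subsumption
    (B₁ : BDDTS L₁ V D I) (B₂ : BDDTS L₂ V D I)
    (hcomp : Compatible B₁ B₂) (hsat₁ : Saturated B₁) (hsat₂ : Saturated B₂)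
    (ini : V → D) (σ : List I) (l : DLoc L₁ L₂) (π : BPath V D I)
    (hπ : π ∈ LP (disj B₁ B₂) σ l) :
    (∀ l₁ : L₁, l.1 = some l₁ → ∃ π₁ ∈ LP B₁ σ l₁, PathSub π₁ π) ∧
    (∀ l₂ : L₂, l.2 = some l₂ → ∃ π₂ ∈ LP B₂ σ l₂, PathSub π₂ π) := by
  obtain ⟨hrun, rfl⟩ := hπ
  constructor
  · intro l₁ hl
    obtain ⟨r, hr, ϖ, hϖ, hsub⟩ := hrun.exists_pathSub Prod.fst DTrans.exists_fst l₁ hl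
    cases hr
    exact ⟨ϖ, ⟨hϖ, hsub.iseq_eq⟩, hsub⟩
  · intro l₂ hl
    obtain ⟨r, hr, ϖ, hϖ, hsub⟩ := hrun.exists_pathSub Prod.snd (DTrans.exists_snd hcomp) l₂ hl
    cases hr
    exact ⟨ϖ, ⟨hϖ, hsub.iseq_eq⟩, hsub⟩
end

section
/- Saturation is preserved by disjunction composition: if B₁ and B₂ are compatible saturated BDDTSs, then B₁ ▽ B₂ is saturated; in particular, for every location of B₁ ▽ B₂ and every interaction α, the disjunction of the guards of its outgoing α-switches is logically equivalent to true, and the guard of every switch from the initial location to a non-sink location implies the initial guard IG₁ ∨ IG₂. -/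
/-!
A formal model of BDDTSs (Behaviour-Driven Development Transition Systems).

Formulas are modelled semantically:
* `D` is the type of data values (closed terms are identified with the values they denote);
* a *world* `w : ℕ → D` is a valuation of the (indexed, `⇑`-shifted) interaction variables;
* a switch guard is a set of pairs (data valuation, current interaction parameter);
* an initial guard / output goal is a set of data valuations;
* a *condition* (path condition, execution condition, goal implication) is a set of pairs
  (data valuation, world); logical equivalence of such formulas is equality of sets,
  implication is inclusion.
-/

universe u

variable {V D I L L₁ L₂ : Type}

/-- In a saturated BDDTS, an enabled interaction has a switch whose guard holds at a given point. -/
theorem Saturated.exists_trans {B : BDDTS L V D I} (h : Saturated B) {l : L} {α : I}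
    (hα : ∃ φ a l', B.trans l α φ a l') (p : (V → D) × D) :
    ∃ φ a l', B.trans l α φ a l' ∧ p ∈ φ := by
  have hp : p ∈ sSup {φ : SForm V D | ∃ a l', B.trans l α φ a l'} := by
    rw [h.1 l α hα]; trivial
  obtain ⟨φ, ⟨a, l', ht⟩, hφ⟩ := hp
  exact ⟨φ, a, l', ht, hφ⟩

/-- The outgoing guards of the disjunction composition cover every point, for an enabled
interaction. -/
theorem DTrans.exists_mem_guard {B₁ : BDDTS L₁ V D I} {B₂ : BDDTS L₂ V D I}
    (hsat₁ : Saturated B₁) (hsat₂ : Saturated B₂) {l l' : DLoc L₁ L₂} {α : I}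
    {φ : SForm V D} {a : Assign V D} (h : DTrans B₁ B₂ l α φ a l') (p : (V → D) × D) :
    ∃ ψ b l'', DTrans B₁ B₂ l α ψ b l'' ∧ p ∈ ψ := by
  cases h with
  | sync h₁ h₂ =>
    obtain ⟨_, _, _, t₁, hp₁⟩ := hsat₁.exists_trans ⟨_, _, _, h₁⟩ p
    obtain ⟨_, _, _, t₂, hp₂⟩ := hsat₂.exists_trans ⟨_, _, _, h₂⟩ p
    exact ⟨_, _, _, .sync t₁ t₂, hp₁, hp₂⟩
  | left h₁ hn =>
    obtain ⟨_, _, _, t₁, hp₁⟩ := hsat₁.exists_trans ⟨_, _, _, h₁⟩ p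
    exact ⟨_, _, _, .left t₁ hn, hp₁⟩
  | right h₂ hn =>
    obtain ⟨_, _, _, t₂, hp₂⟩ := hsat₂.exists_trans ⟨_, _, _, h₂⟩ p
    exact ⟨_, _, _, .right t₂ hn, hp₂⟩

/-- **Saturation is preserved by disjunction composition**: if `B₁` and `B₂` are
compatible saturated BDDTSs then `B₁ ▽ B₂` is saturated, i.e. for every location of
`B₁ ▽ B₂` and every interaction `α` the disjunction of the guards of its outgoing
`α`-switches is logically equivalent to `true`, and the guard of every switch from the
initial location to a non-sink location implies the initial guard `IG₁ ∨ IG₂`. -/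
theorem saturation_preserved
    (B₁ : BDDTS L₁ V D I) (B₂ : BDDTS L₂ V D I)
    (hcomp : Compatible B₁ B₂) (hsat₁ : Saturated B₁) (hsat₂ : Saturated B₂) :
    Saturated (disj B₁ B₂) := by
  refine ⟨?_, ?_⟩
  · rintro l α ⟨_, _, _, h⟩
    refine Set.eq_univ_of_forall fun p => ?_
    obtain ⟨ψ, b, l'', t, hp⟩ := DTrans.exists_mem_guard hsat₁ hsat₂ h p
    exact ⟨ψ, ⟨b, l'', t⟩, hp⟩
  · rintro α φ a l' (⟨h₁, h₂⟩ | ⟨h₁, -⟩ | ⟨h₂, -⟩) ⟨_, _, _, _, hnext⟩ p hp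
    · rcases hnext with ⟨t₁, -⟩ | ⟨t₁, -⟩ | ⟨t₂, -⟩
      · exact .inl (hsat₁.2 _ _ _ _ h₁ ⟨_, _, _, _, t₁⟩ p hp.1)
      · exact .inl (hsat₁.2 _ _ _ _ h₁ ⟨_, _, _, _, t₁⟩ p hp.1)
      · exact .inr (hsat₂.2 _ _ _ _ h₂ ⟨_, _, _, _, t₂⟩ p hp.2)
    · obtain - | ⟨t₁, -⟩ := hnext
      exact .inl (hsat₁.2 _ _ _ _ h₁ ⟨_, _, _, _, t₁⟩ p hp)
    · obtain - | - | ⟨t₂, -⟩ := hnext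
      exact .inr (hsat₂.2 _ _ _ _ h₂ ⟨_, _, _, _, t₂⟩ p hp)
end
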